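/- Let a linear pentapod design have a planar base and suppose there exist α, β ∈ ℝ with r_j = α x_j + β y_j for all j = 1,…,5 (the design family with singularity polynomial linear in the position variables). Then for every fixed position (p_x,p_y,p_z) ∈ ℝ³ there exist real numbers A_1, A_2, A_3, A_4 (depending on the design and the position) such that det S(u,v,w,p_x,p_y,p_z) = w·(A_1 u + A_2 v + A_3 w + A_4) for all (u,v,w) ∈ ℝ³. -/

import Mathlib

open Matrix

/-- The 7×7 matrix `S` of a linear pentapod design with platform parameters
`r` and base coordinates `x`, `y`, `z` (indices `1,…,4` of `Fin 5` correspond to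
legs `2,…,5`; index `0` corresponds to leg `1`), at pose `(u,v,w,px,py,pz)`. -/
noncomputable def Smat (r x y z : Fin 5 → ℝ) (u v w px py pz : ℝ) :
    Matrix (Fin 7) (Fin 7) ℝ :=
  !![(1 : ℝ), u, v, w, px, py, pz;
     0, px, py, pz, 0, 0, 0;
     0, 0, 0, 0, u, v, w;
     r 1, x 1, y 1, z 1, r 1 * x 1, r 1 * y 1, r 1 * z 1;
     r 2, x 2, y 2, z 2, r 2 * x 2, r 2 * y 2, r 2 * z 2;
     r 3, x 3, y 3, z 3, r 3 * x 3, r 3 * y 3, r 3 * z 3;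
     r 4, x 4, y 4, z 4, r 4 * x 4, r 4 * y 4, r 4 * z 4]

/-- The 4×7 architecture matrix of the design. -/
noncomputable def archMat (r x y z : Fin 5 → ℝ) : Matrix (Fin 4) (Fin 7) ℝ :=
  !![r 1, x 1, y 1, z 1, r 1 * x 1, r 1 * y 1, r 1 * z 1;
     r 2, x 2, y 2, z 2, r 2 * x 2, r 2 * y 2, r 2 * z 2;
     r 3, x 3, y 3, z 3, r 3 * x 3, r 3 * y 3, r 3 * z 3;
     r 4, x 4, y 4, z 4, r 4 * x 4, r 4 * y 4, r 4 * z 4]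

/-- The design is architecturally singular: the singularity polynomial `det S`
vanishes at every pose on the quadric `u² + v² + w² = 1`. -/
def ArchSingular (r x y z : Fin 5 → ℝ) : Prop :=
  ∀ u v w px py pz : ℝ, u ^ 2 + v ^ 2 + w ^ 2 = 1 →
    (Smat r x y z u v w px py pz).det = 0

/-- The bracket `[A₁, A₂, A₃, A₄]`: the determinant of the 4×4 matrix with
columns `A₁, A₂, A₃, A₄`. -/
noncomputable def bracket (A1 A2 A3 A4 : Fin 4 → ℝ) : ℝ :=
  (Matrix.of fun i j => ![A1, A2, A3, A4] j i).det

/-- The vector in `ℝ⁴` formed by the values of `f` at legs `2,…,5`. -/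
def colVec (f : Fin 5 → ℝ) : Fin 4 → ℝ := fun i => f i.succ

/-- The componentwise product vector (e.g. `rX`, `rY`, `rZ`) for legs `2,…,5`. -/
def colProd (r f : Fin 5 → ℝ) : Fin 4 → ℝ := fun i => r i.succ * f i.succ

/-- The base anchor point `M_j = (x_j, y_j, z_j) ∈ ℝ³`. -/
def Mpt (x y z : Fin 5 → ℝ) (j : Fin 5) : Fin 3 → ℝ := ![x j, y j, z j]

/-- For a planar base and `r` linear in the base coordinates, the singularity polynomial splits
into a factor depending only on the design and one that is affine in the position. -/
lemma det_Smat_of_planar {r x y z : Fin 5 → ℝ} {α β : ℝ} (hz : ∀ j, z j = 0)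
    (hr : ∀ j, r j = α * x j + β * y j) (u v w px py pz : ℝ) :
    (Smat r x y z u v w px py pz).det =
      w * ((1 - α * u - β * v) * pz + (α * px + β * py) * w) *
        bracket (colVec x) (colVec y) (colProd r x) (colProd r y) := by
  let T : Matrix (Fin 7) (Fin 7) ℝ :=
    !![1, 0, 0, 0, 0, 0, 0;
       -α, 0, 0, 1, 0, 0, 0;
       -β, 0, 0, 0, 1, 0, 0;
       0, 1, 0, 0, 0, 0, 0;
       0, 0, 0, 0, 0, 1, 0;
       0, 0, 0, 0, 0, 0, 1;
       0, 0, 1, 0, 0, 0, 0]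
  let e : Fin 3 ⊕ Fin 4 ≃ Fin 7 := finSumFinEquiv
  have hT : T.det = 1 := by
    simp [T, det_succ_row_zero, Fin.sum_univ_succ, Fin.succAbove]
  have hmul : Smat r x y z u v w px py pz * T =
      !![1 - α * u - β * v, w, pz, u, v, px, py;
         -(α * px + β * py), pz, 0, px, py, 0, 0;
         0, 0, w, 0, 0, u, v;
         0, 0, 0, x 1, y 1, r 1 * x 1, r 1 * y 1;
         0, 0, 0, x 2, y 2, r 2 * x 2, r 2 * y 2;
         0, 0, 0, x 3, y 3, r 3 * x 3, r 3 * y 3;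
         0, 0, 0, x 4, y 4, r 4 * x 4, r 4 * y 4] := by
    simp only [Smat, T, cons_mul, vecMul_cons, empty_mul, hz, hr]
    simp
    ring_nf
    simp
  have hblock : (Smat r x y z u v w px py pz * T).submatrix e e =
      fromBlocks
        !![1 - α * u - β * v, w, pz; -(α * px + β * py), pz, 0; 0, 0, w]
        !![u, v, px, py; px, py, 0, 0; 0, 0, u, v]
        0
        (Matrix.of fun i j => ![colVec x, colVec y, colProd r x, colProd r y] j i) := by
    rw [hmul]
    ext (i | i) (j | j) <;> fin_cases i <;> fin_cases j <;> rfl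
  have hdet : (Smat r x y z u v w px py pz).det = (Smat r x y z u v w px py pz * T).det := by
    rw [det_mul, hT, mul_one]
  rw [hdet, ← det_submatrix_equiv_self e, hblock, det_fromBlocks_zero₂₁, det_fin_three, bracket]
  congr 1
  simp
  ring

theorem stmt14 (r x y z : Fin 5 → ℝ)
    (hr1 : r 0 = 0) (hx1 : x 0 = 0) (hy1 : y 0 = 0) (hz1 : z 0 = 0)
    (hplanar : ∀ j, z j = 0)
    (hκ : ∃ α β : ℝ, ∀ j : Fin 5, r j = α * x j + β * y j) :
    ∀ px py pz : ℝ, ∃ A1 A2 A3 A4 : ℝ, ∀ u v w : ℝ,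
      (Smat r x y z u v w px py pz).det =
        w * (A1 * u + A2 * v + A3 * w + A4) := by
  obtain ⟨α, β, hr⟩ := hκ
  intro px py pz
  set D := bracket (colVec x) (colVec y) (colProd r x) (colProd r y) with hD
  refine ⟨-α * pz * D, -β * pz * D, (α * px + β * py) * D, pz * D, fun u v w => ?_⟩
  rw [det_Smat_of_planar hplanar hr, ← hD]
  ring
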